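/- (Theorem 3.2, Crank–Nicholson energy conservation.) Let τ ∈ ℝ, let u⁰, u¹ : Fin N → ℝ, and let d : Fin N → ℝ be a discrete gradient of the nonlinear potential, i.e. d_j·(u¹_j − u⁰_j) = (u¹_j)^{m+1} − (u⁰_j)^{m+1} for every j (when u¹_j² ≠ u⁰_j² this is the paper's quotient ((u¹_j)^{m+1} − (u⁰_j)^{m+1})/((u¹_j)² − (u⁰_j)²) multiplied by u¹_j + u⁰_j). Suppose the modified Crank–Nicholson scheme holds in Fin N → ℂ: u¹ − u⁰ = τ·B_{S1}( B_{HS1}w − (1/(m(m+1)))·d ), where w := (u⁰ + u¹)/2. Then the discrete energy is conserved exactly: E_h(u¹) = E_h(u⁰), where E_h(u) := (1/2)·⟨B_{HS1}u, u⟩_h − (1/(m(m+1)))·⟨u^{∘m}, u⟩_h. -/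

import Mathlib

open Matrix Complex BigOperators

noncomputable section

/-- The shifted integer index `k̂ = k - N/2` associated to `k ∈ Fin N`. -/
def khat (N : ℕ) (k : Fin N) : ℤ := (k : ℤ) - (N : ℤ) / 2

/-- The collocation angles `θ_j = 2π ĵ / N`. -/
def theta (N : ℕ) (j : Fin N) : ℝ := 2 * Real.pi * (khat N j : ℝ) / N

/-- The discrete Fourier matrix `F`, `F_{k,j} = (1/N) exp(-i k̂ θ_j)`. -/
def Fm (N : ℕ) : Matrix (Fin N) (Fin N) ℂ :=
  Matrix.of fun k j => (N : ℂ)⁻¹ * Complex.exp (-Complex.I * (khat N k : ℂ) * (theta N j : ℂ))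

/-- The inverse discrete Fourier matrix `G`, `G_{j,k} = exp(i k̂ θ_j)`. -/
def Gm (N : ℕ) : Matrix (Fin N) (Fin N) ℂ :=
  Matrix.of fun j k => Complex.exp (Complex.I * (khat N k : ℂ) * (theta N j : ℂ))

/-- The diagonal weight matrix `P = diag(α - i x_j)`. -/
def Pm (N : ℕ) (α : ℝ) (x : Fin N → ℝ) : Matrix (Fin N) (Fin N) ℂ :=
  Matrix.diagonal fun j => (α : ℂ) - Complex.I * (x j : ℂ)

/-- The diagonal matrix `P⁻¹ = diag((α - i x_j)⁻¹)`. -/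
def PinvM (N : ℕ) (α : ℝ) (x : Fin N → ℝ) : Matrix (Fin N) (Fin N) ℂ :=
  Matrix.diagonal fun j => ((α : ℂ) - Complex.I * (x j : ℂ))⁻¹

/-- The diagonal matrix `P̄ = diag(α + i x_j)`. -/
def PbarM (N : ℕ) (α : ℝ) (x : Fin N → ℝ) : Matrix (Fin N) (Fin N) ℂ :=
  Matrix.diagonal fun j => (α : ℂ) + Complex.I * (x j : ℂ)

/-- The discrete Hilbert transform matrix `H = diag(-i sgn(k̂))` with `sgn(0) = 1`. -/
def Hm (N : ℕ) : Matrix (Fin N) (Fin N) ℂ :=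
  Matrix.diagonal fun k => if 0 ≤ khat N k then -Complex.I else Complex.I

/-- The tridiagonal differentiation matrix `S1`:
`(S1)_{k,k-1} = i k̂/(2α)`, `(S1)_{k,k} = i (2k̂+1)/(2α)`, `(S1)_{k,k+1} = i (k̂+1)/(2α)`. -/
def S1 (N : ℕ) (α : ℝ) : Matrix (Fin N) (Fin N) ℂ :=
  Matrix.of fun k l =>
    if (l : ℤ) = (k : ℤ) - 1 then Complex.I * (khat N k : ℂ) / (2 * (α : ℂ))
    else if (l : ℤ) = (k : ℤ) then Complex.I * (2 * (khat N k : ℂ) + 1) / (2 * (α : ℂ))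
    else if (l : ℤ) = (k : ℤ) + 1 then Complex.I * ((khat N k : ℂ) + 1) / (2 * (α : ℂ))
    else 0

/-- The second-derivative matrix `S2 = S1 · S1`. -/
def S2 (N : ℕ) (α : ℝ) : Matrix (Fin N) (Fin N) ℂ := S1 N α * S1 N α

/-- The discrete inner product `⟨u,v⟩_h = (π/(Nα)) Σ_j (α² + x_j²) u_j conj(v_j)`. -/
def iph (N : ℕ) (α : ℝ) (x : Fin N → ℝ) (u v : Fin N → ℂ) : ℂ :=
  ((Real.pi / (N * α) : ℝ) : ℂ) *
    ∑ j, ((α ^ 2 + x j ^ 2 : ℝ) : ℂ) * u j * (starRingEnd ℂ) (v j)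

/-- The conjugated first-derivative operator `B_{S1} = P⁻¹ G S1 F P`. -/
def BS1 (N : ℕ) (α : ℝ) (x : Fin N → ℝ) : Matrix (Fin N) (Fin N) ℂ :=
  PinvM N α x * Gm N * S1 N α * Fm N * Pm N α x

/-- The conjugated operator `B_{HS1} = P⁻¹ G H S1 F P`. -/
def BHS1 (N : ℕ) (α : ℝ) (x : Fin N → ℝ) : Matrix (Fin N) (Fin N) ℂ :=
  PinvM N α x * Gm N * Hm N * S1 N α * Fm N * Pm N α x

/-- The conjugated dispersion operator `B_{HS2} = P⁻¹ G H S2 F P`. -/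
def BHS2 (N : ℕ) (α : ℝ) (x : Fin N → ℝ) : Matrix (Fin N) (Fin N) ℂ :=
  PinvM N α x * Gm N * Hm N * S2 N α * Fm N * Pm N α x

/-- Coercion of a real vector into a complex vector. -/
def cv (N : ℕ) (u : Fin N → ℝ) : Fin N → ℂ := fun j => (u j : ℂ)

/-- Entrywise `m`-th power of a complex vector. -/
def pw (N : ℕ) (m : ℕ) (u : Fin N → ℂ) : Fin N → ℂ := fun j => u j ^ m

/-- The mass-conservative semi-discrete right-hand side
`f_M(w) = B_{HS2} w - (1/(m+1)) (w^{∘(m-1)} ⊙ (B_{S1} w) + B_{S1}(w^{∘m}))`. -/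
def fM (N : ℕ) (α : ℝ) (x : Fin N → ℝ) (m : ℕ) (w : Fin N → ℂ) : Fin N → ℂ :=
  fun j => (BHS2 N α x *ᵥ w) j
    - (1 / ((m : ℂ) + 1)) *
        ((w j) ^ (m - 1) * (BS1 N α x *ᵥ w) j + (BS1 N α x *ᵥ pw N m w) j)

/-- The energy-conservative semi-discrete right-hand side
`f_E(w) = -B_{S1}(-B_{HS1} w + (1/m) w^{∘m})`. -/
def fE (N : ℕ) (α : ℝ) (x : Fin N → ℝ) (m : ℕ) (w : Fin N → ℂ) : Fin N → ℂ :=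
  -(BS1 N α x *ᵥ (-(BHS1 N α x *ᵥ w) + (1 / (m : ℂ)) • pw N m w))

/-- The semi-discrete energy
`E_h(w) = (1/2)⟨B_{HS1} w, w⟩_h - (1/(m(m+1)))⟨w^{∘m}, w⟩_h`. -/
def Eh (N : ℕ) (α : ℝ) (x : Fin N → ℝ) (m : ℕ) (w : Fin N → ℂ) : ℂ :=
  (1 / 2 : ℂ) * iph N α x (BHS1 N α x *ᵥ w) w
    - (1 / ((m : ℂ) * ((m : ℂ) + 1))) * iph N α x (pw N m w) w

end

/-- The diagonal matrix of weights `α² + x_j²` of the discrete inner product. -/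
def weightM (N : ℕ) (α : ℝ) (x : Fin N → ℝ) : Matrix (Fin N) (Fin N) ℂ :=
  Matrix.diagonal fun j => ((α ^ 2 + x j ^ 2 : ℝ) : ℂ)

theorem star_dotProduct_mulVec_star {n : Type*} [Fintype n] (M : Matrix n n ℂ) (u v : n → ℂ) :
    star (star v ⬝ᵥ M *ᵥ u) = star u ⬝ᵥ Mᴴ *ᵥ v := by
  rw [Matrix.star_dotProduct, star_star, Matrix.star_mulVec, ← Matrix.dotProduct_mulVec]

theorem iph_eq_dotProduct (N : ℕ) (α : ℝ) (x : Fin N → ℝ) (u v : Fin N → ℂ) :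
    iph N α x u v
      = ((Real.pi / (N * α) : ℝ) : ℂ) * (star v ⬝ᵥ weightM N α x *ᵥ u) := by
  simp only [iph, weightM, dotProduct, Matrix.mulVec_diagonal, Pi.star_apply, starRingEnd_apply]
  congr 1
  exact Finset.sum_congr rfl fun j _ => by ring

theorem iph_mulVec_eq_dotProduct (N : ℕ) (α : ℝ) (x : Fin N → ℝ)
    (A : Matrix (Fin N) (Fin N) ℂ) (u v : Fin N → ℂ) :
    iph N α x (A *ᵥ u) v
      = ((Real.pi / (N * α) : ℝ) : ℂ) * (star v ⬝ᵥ (weightM N α x * A) *ᵥ u) := by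
  rw [iph_eq_dotProduct, Matrix.mulVec_mulVec]

section InnerProduct

variable (N : ℕ) (α : ℝ) (x : Fin N → ℝ) (u v w : Fin N → ℂ) (c : ℂ)

theorem iph_add_left : iph N α x (u + v) w = iph N α x u w + iph N α x v w := by
  simp only [iph_eq_dotProduct, Matrix.mulVec_add, dotProduct_add, mul_add]

theorem iph_sub_left : iph N α x (u - v) w = iph N α x u w - iph N α x v w := by
  simp only [iph_eq_dotProduct, Matrix.mulVec_sub, dotProduct_sub, mul_sub]

theorem iph_smul_left : iph N α x (c • u) v = c * iph N α x u v := by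
  simp only [iph_eq_dotProduct, Matrix.mulVec_smul, dotProduct_smul, smul_eq_mul]
  ring

theorem iph_sub_right : iph N α x u (v - w) = iph N α x u v - iph N α x u w := by
  simp only [iph_eq_dotProduct, star_sub, sub_dotProduct, mul_sub]

theorem iph_smul_right : iph N α x u (c • v) = star c * iph N α x u v := by
  simp only [iph_eq_dotProduct, star_smul, smul_dotProduct, smul_eq_mul]
  ring

theorem star_iph : star (iph N α x u v) = iph N α x v u := by
  simp only [iph, ← starRingEnd_apply, map_mul, map_sum, Complex.conj_ofReal, Complex.conj_conj]
  congr 1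
  exact Finset.sum_congr rfl fun j _ => by ring

theorem star_iph_mulVec_of_isHermitian {A : Matrix (Fin N) (Fin N) ℂ}
    (hA : (weightM N α x * A).IsHermitian) :
    star (iph N α x (A *ᵥ u) v) = iph N α x (A *ᵥ v) u := by
  rw [iph_mulVec_eq_dotProduct, iph_mulVec_eq_dotProduct, star_mul', star_dotProduct_mulVec_star,
    hA.eq, ← starRingEnd_apply, Complex.conj_ofReal]

theorem star_iph_mulVec_of_skew {A : Matrix (Fin N) (Fin N) ℂ}
    (hA : (weightM N α x * A)ᴴ = -(weightM N α x * A)) :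
    star (iph N α x (A *ᵥ u) v) = -iph N α x (A *ᵥ v) u := by
  rw [iph_mulVec_eq_dotProduct, iph_mulVec_eq_dotProduct, star_mul', star_dotProduct_mulVec_star,
    hA, ← starRingEnd_apply, Complex.conj_ofReal, Matrix.neg_mulVec, dotProduct_neg, mul_neg]

end InnerProduct

theorem Gm_eq_smul_conjTranspose_Fm (N : ℕ) (hN : 0 < N) : Gm N = (N : ℂ) • (Fm N)ᴴ := by
  have hN' : (N : ℂ) ≠ 0 := by exact_mod_cast hN.ne'
  ext j k
  simp [Gm, Fm, ← Complex.exp_conj, hN']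

theorem weightM_mul_PinvM (N : ℕ) {α : ℝ} (hα : 0 < α) (x : Fin N → ℝ) :
    weightM N α x * PinvM N α x = (Pm N α x)ᴴ := by
  rw [weightM, PinvM, Pm, Matrix.diagonal_mul_diagonal, Matrix.diagonal_conjTranspose]
  congr 1
  ext j
  have h : (α : ℂ) - Complex.I * (x j : ℂ) ≠ 0 := by
    intro h
    have := congrArg Complex.re h
    simp at this
    exact hα.ne' this
  simp only [Pi.star_apply, ← starRingEnd_apply, map_sub, map_mul, Complex.conj_ofReal,
    Complex.conj_I]
  rw [← div_eq_mul_inv, div_eq_iff h]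
  push_cast
  linear_combination (x j : ℂ) ^ 2 * Complex.I_sq

theorem weightM_mul_conj_eq (N : ℕ) (hN : 0 < N) {α : ℝ} (hα : 0 < α) (x : Fin N → ℝ)
    (M : Matrix (Fin N) (Fin N) ℂ) :
    weightM N α x * (PinvM N α x * Gm N * M * Fm N * Pm N α x)
      = (N : ℂ) • ((Fm N * Pm N α x)ᴴ * M * (Fm N * Pm N α x)) := by
  rw [Matrix.conjTranspose_mul, ← weightM_mul_PinvM N hα x, Gm_eq_smul_conjTranspose_Fm N hN]
  simp only [Matrix.mul_assoc, Matrix.smul_mul, Matrix.mul_smul]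

theorem conjTranspose_S1 (N : ℕ) (α : ℝ) : (S1 N α)ᴴ = -S1 N α := by
  ext k l
  simp only [Matrix.conjTranspose_apply, Matrix.neg_apply, S1, Matrix.of_apply, khat]
  have hcast : ∀ a b : ℤ, a = b → (a : ℂ) = (b : ℂ) := fun _ _ h => congrArg _ h
  split_ifs
  all_goals first | omega | skip
  all_goals
    simp only [← starRingEnd_apply, map_div₀, map_mul, map_add, map_one, map_zero,
      Complex.conj_I, Complex.conj_ofReal, map_intCast, map_ofNat, neg_zero]
  · have h := hcast (k : ℤ) (l - 1) (by omega)
    push_cast at h ⊢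
    rw [h]
    ring
  · have h := hcast (k : ℤ) l (by omega)
    push_cast at h ⊢
    rw [h]
    ring
  · have h := hcast (k : ℤ) (l + 1) (by omega)
    push_cast at h ⊢
    rw [h]
    ring

theorem Hm_mul_S1_comm (N : ℕ) (α : ℝ) : Hm N * S1 N α = S1 N α * Hm N := by
  ext k l
  rw [Hm, Matrix.diagonal_mul, Matrix.mul_diagonal]
  have key : (S1 N α) k l = 0 ∨ (0 ≤ khat N k ↔ 0 ≤ khat N l) := by
    by_cases h : 0 ≤ khat N k ↔ 0 ≤ khat N l
    · exact Or.inr h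
    · left
      simp only [S1, Matrix.of_apply]
      split_ifs with h1 h2 h3
      · have : khat N k = 0 := by unfold khat at *; omega
        simp [this]
      · unfold khat at *; omega
      · have : khat N k = -1 := by unfold khat at *; omega
        simp [this]
      · rfl
  rcases key with h | h
  · simp [h]
  · simp only [h, mul_comm]

theorem conjTranspose_Hm (N : ℕ) : (Hm N)ᴴ = -Hm N := by
  rw [Hm, Matrix.diagonal_conjTranspose, Matrix.diagonal_neg]
  congr 1
  ext k
  simp only [Pi.star_apply]
  split_ifs <;> simp

theorem isHermitian_Hm_mul_S1 (N : ℕ) (α : ℝ) : (Hm N * S1 N α).IsHermitian := by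
  rw [Matrix.IsHermitian, Matrix.conjTranspose_mul, conjTranspose_Hm, conjTranspose_S1,
    neg_mul_neg, Hm_mul_S1_comm]

theorem isHermitian_weightM_mul_BHS1 (N : ℕ) (hN : 0 < N) {α : ℝ} (hα : 0 < α)
    (x : Fin N → ℝ) : (weightM N α x * BHS1 N α x).IsHermitian := by
  rw [BHS1, Matrix.mul_assoc _ (Hm N), weightM_mul_conj_eq N hN hα, Matrix.IsHermitian,
    Matrix.conjTranspose_smul,
    (Matrix.isHermitian_conjTranspose_mul_mul _ (isHermitian_Hm_mul_S1 N α)).eq, star_natCast]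

theorem conjTranspose_weightM_mul_BS1 (N : ℕ) (hN : 0 < N) {α : ℝ} (hα : 0 < α)
    (x : Fin N → ℝ) : (weightM N α x * BS1 N α x)ᴴ = -(weightM N α x * BS1 N α x) := by
  rw [BS1, weightM_mul_conj_eq N hN hα, Matrix.conjTranspose_smul, star_natCast]
  simp only [Matrix.conjTranspose_mul, Matrix.conjTranspose_conjTranspose, conjTranspose_S1,
    Matrix.mul_assoc, Matrix.neg_mul, Matrix.mul_neg, smul_neg]

theorem star_iph_pw_cv (N : ℕ) (α : ℝ) (x : Fin N → ℝ) (m : ℕ) (u : Fin N → ℝ) :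
    star (iph N α x (pw N m (cv N u)) (cv N u)) = iph N α x (pw N m (cv N u)) (cv N u) := by
  simp only [iph, pw, cv, ← starRingEnd_apply, map_mul, map_sum, map_pow, Complex.conj_ofReal]

theorem star_Eh_cv (N : ℕ) (hN : 0 < N) {α : ℝ} (hα : 0 < α) (x : Fin N → ℝ) (m : ℕ)
    (u : Fin N → ℝ) : star (Eh N α x m (cv N u)) = Eh N α x m (cv N u) := by
  rw [Eh, star_sub, star_mul', star_mul', star_iph_pw_cv,
    star_iph_mulVec_of_isHermitian _ _ _ _ _ (isHermitian_weightM_mul_BHS1 N hN hα x)]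
  simp

theorem iph_discrete_gradient (N : ℕ) (α : ℝ) (x : Fin N → ℝ) (m : ℕ) (u0 u1 d : Fin N → ℝ)
    (hd : ∀ j, d j * (u1 j - u0 j) = (u1 j) ^ (m + 1) - (u0 j) ^ (m + 1)) :
    iph N α x (cv N d) (cv N u1 - cv N u0)
      = iph N α x (pw N m (cv N u1)) (cv N u1) - iph N α x (pw N m (cv N u0)) (cv N u0) := by
  simp only [iph, ← mul_sub, ← Finset.sum_sub_distrib]
  congr 1
  refine Finset.sum_congr rfl fun j _ => ?_
  have h : (d j : ℂ) * (u1 j - u0 j) = (u1 j : ℂ) ^ (m + 1) - (u0 j : ℂ) ^ (m + 1) := by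
    exact_mod_cast hd j
  simp only [cv, pw, Pi.sub_apply, map_sub, Complex.conj_ofReal]
  linear_combination ((α ^ 2 + x j ^ 2 : ℝ) : ℂ) * h

open Matrix in
/-- Theorem 3.2 (Crank–Nicholson energy conservation): if `d` is a discrete gradient
of the nonlinear potential, i.e. `d_j (u¹_j - u⁰_j) = (u¹_j)^{m+1} - (u⁰_j)^{m+1}`
for every `j`, and the modified Crank–Nicholson scheme
`u¹ - u⁰ = τ B_{S1}(B_{HS1} w - (1/(m(m+1))) d)` with `w = (u⁰+u¹)/2` holds, then
the discrete energy is conserved exactly: `E_h(u¹) = E_h(u⁰)`. -/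
theorem crank_nicholson_energy_conservation (N : ℕ) (hN : Even N) (hN0 : 0 < N)
    (α : ℝ) (hα : 0 < α) (x : Fin N → ℝ) (m : ℕ) (hm : 1 ≤ m)
    (τ : ℝ) (u0 u1 d : Fin N → ℝ)
    (hd : ∀ j, d j * (u1 j - u0 j) = (u1 j) ^ (m + 1) - (u0 j) ^ (m + 1))
    (hscheme : cv N u1 - cv N u0
      = (τ : ℂ) • (BS1 N α x *ᵥ
          (BHS1 N α x *ᵥ ((cv N u0 + cv N u1) / 2)
            - (1 / ((m : ℂ) * ((m : ℂ) + 1))) • cv N d))) :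
    Eh N α x m (cv N u1) = Eh N α x m (cv N u0) := by
  set A := BHS1 N α x
  set B := BS1 N α x
  set c : ℂ := 1 / ((m : ℂ) * ((m : ℂ) + 1))
  set g := A *ᵥ ((cv N u0 + cv N u1) / 2) - c • cv N d with hg
  have hA := isHermitian_weightM_mul_BHS1 N hN0 hα x
  have hB := conjTranspose_weightM_mul_BS1 N hN0 hα x
  have hskew : star (iph N α x g (cv N u1 - cv N u0)) = -iph N α x g (cv N u1 - cv N u0) := by
    have h := star_iph_mulVec_of_skew N α x g g hB
    rw [hscheme, iph_smul_right, ← star_iph N α x (B *ᵥ g) g, h, star_mul', star_neg, h]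
    simp
  have hmid : (cv N u0 + cv N u1) / 2 = (1 / 2 : ℂ) • (cv N u0 + cv N u1) := by
    ext j
    simp
    ring
  have hexp : Eh N α x m (cv N u1) - Eh N α x m (cv N u0)
      = iph N α x g (cv N u1 - cv N u0)
        - (1 / 2) * (iph N α x (A *ᵥ cv N u0) (cv N u1)
          - iph N α x (A *ᵥ cv N u1) (cv N u0)) := by
    rw [hg, iph_sub_left, iph_smul_left, iph_discrete_gradient N α x m u0 u1 d hd, hmid,
      Matrix.mulVec_smul, iph_smul_left, Matrix.mulVec_add, iph_add_left, iph_sub_right,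
      iph_sub_right, Eh, Eh]
    ring
  have hstar := congrArg star hexp
  rw [star_sub, star_Eh_cv N hN0 hα, star_Eh_cv N hN0 hα, star_sub, hskew, star_mul', star_sub,
    star_iph_mulVec_of_isHermitian _ _ _ _ _ hA, star_iph_mulVec_of_isHermitian _ _ _ _ _ hA] at hstar
  have half : star (1 / 2 : ℂ) = 1 / 2 := by simp
  rw [half] at hstar
  linear_combination (1 / 2 : ℂ) * hexp + (1 / 2 : ℂ) * hstar
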